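/- Let G = (V, E, W) be a finite undirected weighted graph and T an encoding tree for G. For every internal (non-leaf) node α of T, the difference between the total weight of outer edges of α's children and the total weight of outer edges of α equals twice the total weight of the edges whose least common ancestor is α: ( ∑_{β ∈ children(α)} g(β) ) − g(α) = 2 · ∑_{{x,y}∈E, α_{x∨y} = α} W(x,y). -/

import Mathlib

open scoped Classical
open Finset

/-- An encoding tree for a graph on vertex set `V`: a finite rooted tree (given by a
parent function under which every node reaches the root) together with a bijection
between its leaves and the elements of `V`, and the least-common-ancestor operation. -/
structure EncodingTree (V : Type) [Fintype V] where
  /-- the type of tree nodes -/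
  N : Type
  fintypeN : Fintype N
  root : N
  parent : N → N
  parent_root : parent root = root
  reaches_root : ∀ α : N, ∃ m : ℕ, parent^[m] α = root
  /-- the leaf corresponding to a graph node -/
  leafOf : V → N
  leafOf_inj : Function.Injective leafOf
  /-- the leaves (nodes without children) are exactly the images of graph nodes -/
  leaf_iff : ∀ α : N, (¬ ∃ β : N, β ≠ root ∧ parent β = α) ↔ α ∈ Set.range leafOf
  /-- least common ancestor -/
  lca : N → N → N
  lca_anc_left : ∀ α β : N, ∃ m : ℕ, parent^[m] α = lca α β
  lca_anc_right : ∀ α β : N, ∃ m : ℕ, parent^[m] β = lca α β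
  lca_min : ∀ α β γ : N, (∃ m : ℕ, parent^[m] α = γ) → (∃ m : ℕ, parent^[m] β = γ) →
      ∃ m : ℕ, parent^[m] (lca α β) = γ

attribute [instance] EncodingTree.fintypeN

variable {V : Type} [Fintype V]

/-- weighted degree `d(x) = ∑_{y} W(x,y)` -/
noncomputable def deg (W : V → V → ℝ) (x : V) : ℝ := ∑ y, W x y

/-- total volume `vol(V) = ∑_{x ∈ V} d(x)` -/
noncomputable def volV (W : V → V → ℝ) : ℝ := ∑ x, deg W x

namespace EncodingTree

variable (T : EncodingTree V)

/-- the community of a tree node: graph nodes whose leaves are descendants of it -/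
noncomputable def community (α : T.N) : Finset V :=
  Finset.univ.filter (fun x => ∃ m : ℕ, T.parent^[m] (T.leafOf x) = α)

/-- `vol(α) = ∑_{x ∈ C(α)} d(x)` -/
noncomputable def vol (W : V → V → ℝ) (α : T.N) : ℝ :=
  ∑ x ∈ T.community α, deg W x

/-- `g(α) = ∑_{x ∈ C(α)} ∑_{y ∉ C(α)} W(x,y)` -/
noncomputable def g (W : V → V → ℝ) (α : T.N) : ℝ :=
  ∑ x ∈ T.community α, ∑ y ∈ (T.community α)ᶜ, W x y

/-- structural entropy `H(G,T)` -/
noncomputable def H (W : V → V → ℝ) : ℝ :=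
  -∑ α ∈ Finset.univ.filter (fun α : T.N => α ≠ T.root),
      (T.g W α / volV W) * Real.log (T.vol W α / T.vol W (T.parent α))

end EncodingTree

namespace EncodingTree

variable (T : EncodingTree V)

theorem iterate_parent_root (m : ℕ) : T.parent^[m] T.root = T.root :=
  Function.iterate_fixed T.parent_root m

/-- The root is the only node lying on a cycle of the parent function. -/
theorem eq_root_of_iterate_parent_eq {α : T.N} {k : ℕ} (hk : 0 < k)
    (h : T.parent^[k] α = α) : α = T.root := by
  obtain ⟨m, hm⟩ := T.reaches_root α
  have h1 : T.parent^[k * m] α = α := by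
    rw [Function.iterate_mul]
    exact Function.iterate_fixed h m
  have hle : m ≤ k * m := Nat.le_mul_of_pos_left m hk
  rw [← Nat.sub_add_cancel hle, Function.iterate_add_apply, hm, T.iterate_parent_root] at h1
  exact h1.symm

theorem mem_community {α : T.N} {x : V} :
    x ∈ T.community α ↔ ∃ m : ℕ, T.parent^[m] (T.leafOf x) = α := by
  simp [community]

theorem mem_community_parent {β : T.N} {x : V} (h : x ∈ T.community β) :
    x ∈ T.community (T.parent β) := by
  obtain ⟨m, hm⟩ := T.mem_community.1 h
  exact T.mem_community.2 ⟨m + 1, by rw [Function.iterate_succ_apply', hm]⟩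

theorem mem_community_of_iterate {β γ : T.N} {x : V} (h : x ∈ T.community β)
    (hγ : ∃ m : ℕ, T.parent^[m] β = γ) : x ∈ T.community γ := by
  obtain ⟨m, hm⟩ := T.mem_community.1 h
  obtain ⟨n, hn⟩ := hγ
  exact T.mem_community.2 ⟨n + m, by rw [Function.iterate_add_apply, hm, hn]⟩

/-- A proper descendant of `α` is a descendant of some child of `α`. -/
theorem exists_child_of_iterate {α δ : T.N} (h : ∃ m : ℕ, T.parent^[m] δ = α) (hne : δ ≠ α) :
    ∃ β, (β ≠ T.root ∧ T.parent β = α) ∧ ∃ m : ℕ, T.parent^[m] δ = β := by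
  have hpos : Nat.find h ≠ 0 := fun h0 => hne (by simpa [h0] using Nat.find_spec h)
  obtain ⟨k, hk⟩ := Nat.exists_eq_succ_of_ne_zero hpos
  have hpar : T.parent (T.parent^[k] δ) = α := by
    rw [← Function.iterate_succ_apply' T.parent, ← hk]
    exact Nat.find_spec h
  refine ⟨T.parent^[k] δ, ⟨fun hr => ?_, hpar⟩, k, rfl⟩
  refine Nat.find_min h (m := k) (by omega) ?_
  rw [hr, T.parent_root] at hpar
  rw [hr, hpar]

theorem child_unique_of_le {α β γ δ : T.N} {m n : ℕ} (hmn : m ≤ n)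
    (hβ : T.parent β = α) (hγ : γ ≠ T.root ∧ T.parent γ = α)
    (hm : T.parent^[m] δ = β) (hn : T.parent^[n] δ = γ) : β = γ := by
  obtain ⟨k, rfl⟩ := Nat.exists_eq_add_of_le' hmn
  rw [Function.iterate_add_apply, hm] at hn
  cases k with
  | zero => exact hn
  | succ k =>
    have hk : T.parent^[k + 1] γ = γ := by
      rw [Function.iterate_succ_apply, hγ.2, ← hβ, ← Function.iterate_succ_apply, hn]
    exact absurd (T.eq_root_of_iterate_parent_eq k.succ_pos hk) hγ.1

theorem child_unique {α β γ : T.N} {x : V} (hβ : β ≠ T.root ∧ T.parent β = α)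
    (hγ : γ ≠ T.root ∧ T.parent γ = α) (hxβ : x ∈ T.community β) (hxγ : x ∈ T.community γ) :
    β = γ := by
  obtain ⟨m, hm⟩ := T.mem_community.1 hxβ
  obtain ⟨n, hn⟩ := T.mem_community.1 hxγ
  rcases le_total m n with h | h
  · exact T.child_unique_of_le h hβ.2 hγ hm hn
  · exact (T.child_unique_of_le h hγ.2 hβ hn hm).symm

/-- Two graph nodes below `α` have least common ancestor `α` exactly when the child of `α`
above the first is not above the second. -/
theorem lca_eq_iff_notMem_child {α β : T.N} {x y : V} (hβ : β ≠ T.root ∧ T.parent β = α)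
    (hx : x ∈ T.community β) (hy : y ∈ T.community α) :
    T.lca (T.leafOf x) (T.leafOf y) = α ↔ y ∉ T.community β := by
  constructor
  · intro h hyβ
    obtain ⟨m, hm⟩ := T.lca_min _ _ _ (T.mem_community.1 hx) (T.mem_community.1 hyβ)
    refine hβ.1 (T.eq_root_of_iterate_parent_eq m.succ_pos ?_)
    rw [Function.iterate_succ_apply, hβ.2, ← h, hm]
  · intro hyβ
    by_contra hne
    have hxα : x ∈ T.community α := hβ.2 ▸ T.mem_community_parent hx
    obtain ⟨γ, hγ, hlγ⟩ := T.exists_child_of_iterate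
      (T.lca_min _ _ _ (T.mem_community.1 hxα) (T.mem_community.1 hy)) hne
    have hxγ := T.mem_community_of_iterate (T.mem_community.2 (T.lca_anc_left _ _)) hlγ
    have hyγ := T.mem_community_of_iterate (T.mem_community.2 (T.lca_anc_right _ _)) hlγ
    exact hyβ (T.child_unique hβ hγ hx hxγ ▸ hyγ)

theorem g_eq_sum_ite (W : V → V → ℝ) (α : T.N) :
    T.g W α = ∑ x, ∑ y, if x ∈ T.community α ∧ y ∉ T.community α then W x y else 0 := by
  rw [g, ← Finset.sum_filter_add_sum_filter_not Finset.univ (· ∈ T.community α)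
    (fun x => ∑ y, if x ∈ T.community α ∧ y ∉ T.community α then W x y else 0),
    Finset.sum_eq_zero (s := Finset.univ.filter (· ∉ T.community α)), add_zero,
    Finset.filter_univ_mem]
  · refine Finset.sum_congr rfl fun x hx => ?_
    simp only [hx, true_and, ← Finset.sum_filter, Finset.compl_eq_univ_sdiff,
      Finset.sdiff_eq_filter]
  · intro x hx
    simp [(mem_filter.1 hx).2]

/-- The contribution of an ordered pair of graph nodes to the outer weights of the children of
an internal node `α`, minus its contribution to the outer weight of `α`. -/
theorem sum_children_ite_sub_ite {α : T.N} (hα : ∃ β : T.N, β ≠ T.root ∧ T.parent β = α)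
    (x y : V) (w : ℝ) :
    (∑ β ∈ Finset.univ.filter (fun β : T.N => β ≠ T.root ∧ T.parent β = α),
        if x ∈ T.community β ∧ y ∉ T.community β then w else 0)
      - (if x ∈ T.community α ∧ y ∉ T.community α then w else 0)
      = if T.lca (T.leafOf x) (T.leafOf y) = α then w else 0 := by
  by_cases hx : x ∈ T.community α
  · have hne : T.leafOf x ≠ α := fun h => (T.leaf_iff α).2 ⟨x, h⟩ hα
    obtain ⟨β, hβ, hxβ⟩ := T.exists_child_of_iterate (T.mem_community.1 hx) hne
    rw [← T.mem_community] at hxβ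
    rw [Finset.sum_eq_single_of_mem β (by simpa using hβ)]
    · by_cases hy : y ∈ T.community α
      · simp [hxβ, hy, T.lca_eq_iff_notMem_child hβ hxβ hy]
      · have hyβ : y ∉ T.community β := fun h => hy (hβ.2 ▸ T.mem_community_parent h)
        have hl : T.lca (T.leafOf x) (T.leafOf y) ≠ α := fun h =>
          hy (T.mem_community.2 (h ▸ T.lca_anc_right _ _))
        simp [hx, hy, hxβ, hyβ, hl]
    · intro γ hγ hγβ
      rw [if_neg]
      rintro ⟨hxγ, -⟩
      exact hγβ (T.child_unique (by simpa using hγ) hβ hxγ hxβ)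
  · have hl : T.lca (T.leafOf x) (T.leafOf y) ≠ α := fun h =>
      hx (T.mem_community.2 (h ▸ T.lca_anc_left _ _))
    rw [Finset.sum_eq_zero]
    · simp [hx, hl]
    · intro γ hγ
      rw [if_neg]
      rintro ⟨hxγ, -⟩
      simp only [mem_filter, mem_univ, true_and] at hγ
      exact hx (hγ.2 ▸ T.mem_community_parent hxγ)

end EncodingTree

/-- Summing over ordered pairs counts every off-diagonal unordered pair twice. -/
theorem sum_sum_sym2_mk_eq_two_mul_sum {ι : Type*} [Fintype ι] (F : Sym2 ι → ℝ)
    (hF : ∀ x, F s(x, x) = 0) : ∑ x, ∑ y, F s(x, y) = 2 * ∑ e, F e := by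
  rw [← Fintype.sum_prod_type' (fun x y => F s(x, y)),
    ← Finset.sum_fiberwise Finset.univ (fun p : ι × ι => s(p.1, p.2)), Finset.mul_sum]
  refine Finset.sum_congr rfl fun e _ => ?_
  induction e using Sym2.ind with
  | _ x y =>
  have hconst : ∀ p ∈ Finset.univ.filter (fun p : ι × ι => s(p.1, p.2) = s(x, y)),
      F s(p.1, p.2) = F s(x, y) := fun p hp => by rw [(mem_filter.1 hp).2]
  rw [Finset.sum_congr rfl hconst]
  by_cases hxy : x = y
  · subst hxy
    simp [hF]
  · have hfib : Finset.univ.filter (fun p : ι × ι => s(p.1, p.2) = s(x, y))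
        = {(x, y), (y, x)} := by
      ext ⟨a, b⟩
      simp
    rw [hfib, Finset.sum_pair (by simp [hxy, Ne.symm hxy]), two_mul]

/-- For every internal (non-leaf) node `α` of the encoding tree, the difference between
the total weight of outer edges of `α`'s children and the total weight of outer edges of
`α` equals twice the total weight of the edges whose least common ancestor is `α`:
`(∑_{β ∈ children(α)} g(β)) − g(α) = 2·∑_{{x,y}∈E, α_{x∨y} = α} W(x,y)`.
Here `Wf` is the descent of `W` to unordered pairs and `L` sends an unordered pair of
graph nodes to the least common ancestor of the corresponding leaves. -/
theorem children_outer_edge_difference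
    [Nonempty V] (W : V → V → ℝ) (T : EncodingTree V)
    (hsymm : ∀ x y, W x y = W y x)
    (hdiag : ∀ x, W x x = 0)
    (hnonneg : ∀ x y, 0 ≤ W x y)
    (α : T.N) (hα : ∃ β : T.N, β ≠ T.root ∧ T.parent β = α)
    (Wf : Sym2 V → ℝ) (hWf : ∀ x y, Wf s(x, y) = W x y)
    (L : Sym2 V → T.N) (hL : ∀ x y, L s(x, y) = T.lca (T.leafOf x) (T.leafOf y)) :
    (∑ β ∈ Finset.univ.filter (fun β : T.N => β ≠ T.root ∧ T.parent β = α), T.g W β)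
        - T.g W α
      = 2 * ∑ e ∈ Finset.univ.sym2.filter (fun e => 0 < Wf e ∧ L e = α), Wf e := by
  have hR : ∑ e ∈ Finset.univ.sym2.filter (fun e => 0 < Wf e ∧ L e = α), Wf e
      = ∑ e, if L e = α then Wf e else 0 := by
    rw [Finset.sum_filter, Finset.sym2_univ]
    refine Finset.sum_congr rfl fun e _ => ?_
    induction e using Sym2.ind with
    | _ x y =>
    rcases (hnonneg x y).eq_or_lt with h | h
    · simp [hWf, ← h]
    · simp [hWf, h]
  rw [hR, ← sum_sum_sym2_mk_eq_two_mul_sum _ (fun x => by simp [hWf, hdiag])]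
  simp only [T.g_eq_sum_ite, hWf, hL]
  rw [Finset.sum_comm, ← Finset.sum_sub_distrib]
  refine Finset.sum_congr rfl fun x _ => ?_
  rw [Finset.sum_comm, ← Finset.sum_sub_distrib]
  exact Finset.sum_congr rfl fun y _ => T.sum_children_ite_sub_ite hα x y (W x y)
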